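/- arXiv:1904.06803 — 2 statements merged into one kernel-verified Lean document; each statement's English description precedes it below -/
import Mathlib

section
/- Let n ≥ 3 be an integer, let Q₁ and Q₂ be mutually orthogonal rank-one orthogonal projections in M_n(ℂ), and let Q₃ := I − Q₁ − Q₂. Then the subalgebra 𝒜 := ℂQ₁ + ℂQ₂ + (Q₁+Q₂)·M_n(ℂ)·Q₃ = {αQ₁ + βQ₂ + (Q₁+Q₂)TQ₃ : α, β ∈ ℂ, T ∈ M_n(ℂ)} is idempotent compressible, and consequently its unitization 𝒜 + ℂI is idempotent compressible. -/
open Matrix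

abbrev Mat (n : ℕ) := Matrix (Fin n) (Fin n) ℂ

/-- A set of matrices is closed under multiplication. -/
def MulClosed {n : ℕ} (S : Set (Mat n)) : Prop :=
  ∀ x ∈ S, ∀ y ∈ S, x * y ∈ S

/-- The compression `E 𝒜 E = {E A E : A ∈ 𝒜}` of a set of matrices by `E`. -/
def compress {n : ℕ} (E : Mat n) (A : Set (Mat n)) : Set (Mat n) :=
  (fun M => E * M * E) '' A

/-- `𝒜` is projection compressible: for every orthogonal projection `P`,
`P 𝒜 P` is closed under multiplication. -/
def ProjectionCompressible {n : ℕ} (A : Set (Mat n)) : Prop :=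
  ∀ P : Mat n, P * P = P → Pᴴ = P → MulClosed (compress P A)

/-- `𝒜` is idempotent compressible: for every idempotent `E`,
`E 𝒜 E` is closed under multiplication. -/
def IdempotentCompressible {n : ℕ} (A : Set (Mat n)) : Prop :=
  ∀ E : Mat n, E * E = E → MulClosed (compress E A)

/-- The unitization `𝒜 + ℂ I` of a set of matrices. -/
def unitization {n : ℕ} (A : Set (Mat n)) : Set (Mat n) :=
  {M | ∃ B ∈ A, ∃ α : ℂ, M = B + α • (1 : Mat n)}

theorem Matrix.exists_mul_mul_eq_smul_of_rank_eq_one {n : ℕ} {Q : Mat n} (hQ : Q.rank = 1)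
    (M : Mat n) : ∃ c : ℂ, Q * M * Q = c • Q := by
  obtain ⟨u, w, rfl⟩ : ∃ u w : Fin n → ℂ, Q = vecMulVec u w := by
    obtain ⟨v, -, hv⟩ := finrank_eq_one_iff'.mp hQ
    choose w hw using fun j : Fin n => hv ⟨Q.mulVecLin (Pi.single j 1), LinearMap.mem_range_self _ _⟩
    refine ⟨v, w, ?_⟩
    ext i j
    have h := congrFun (congrArg Subtype.val (hw j)) i
    simp only [Submodule.coe_smul, Pi.smul_apply, mulVecLin_apply, mulVec_single_one, col_apply,
      smul_eq_mul] at h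
    rw [vecMulVec_apply, ← h, mul_comm]
  exact ⟨w ᵥ* M ⬝ᵥ u, by rw [Matrix.mul_assoc, mul_vecMulVec, vecMulVec_mul_vecMulVec,
    vecMulVec_smul, dotProduct_mulVec]⟩

theorem IdempotentCompressible.unitization {n : ℕ} {A : Set (Mat n)}
    (hadd : ∀ x ∈ A, ∀ y ∈ A, x + y ∈ A) (hsmul : ∀ (c : ℂ), ∀ x ∈ A, c • x ∈ A)
    (hA : IdempotentCompressible A) : IdempotentCompressible (unitization A) := by
  rintro E hE _ ⟨_, ⟨B, hB, b, rfl⟩, rfl⟩ _ ⟨_, ⟨C, hC, c, rfl⟩, rfl⟩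
  obtain ⟨D, hD, hDeq⟩ := hA E hE _ ⟨B, hB, rfl⟩ _ ⟨C, hC, rfl⟩
  have hcomp : ∀ (X : Mat n) (x : ℂ), E * (X + x • 1) * E = E * X * E + x • E := by
    intro X x
    simp [mul_add, add_mul, hE]
  have hl : ∀ X : Mat n, E * (E * X * E) = E * X * E := by
    intro X
    simp only [← mul_assoc, hE]
  have hr : ∀ X : Mat n, E * X * E * E = E * X * E := by
    intro X
    rw [mul_assoc, hE]
  refine ⟨_, ⟨D + (b • C + c • B), hadd _ hD _ (hadd _ (hsmul _ _ hC) _ (hsmul _ _ hB)),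
    b * c, rfl⟩, ?_⟩
  beta_reduce at hDeq ⊢
  simp only [hcomp]
  simp only [mul_add E, add_mul, mul_add, hDeq, smul_mul_assoc, mul_smul_comm, hl, hr, hE]
  module

/-- If `Q₁, Q₂` are mutually orthogonal rank-one orthogonal projections in `Mₙ(ℂ)`
(`n ≥ 3`) and `Q₃ = I - Q₁ - Q₂`, then `ℂQ₁ + ℂQ₂ + (Q₁+Q₂) Mₙ(ℂ) Q₃` is idempotent
compressible, and so is its unitization. -/
theorem example_3_1_3 {n : ℕ} (hn : 3 ≤ n) (Q₁ Q₂ Q₃ : Mat n)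
    (hQ₁ : Q₁ * Q₁ = Q₁) (hQ₁' : Q₁ᴴ = Q₁) (hQ₁r : Q₁.rank = 1)
    (hQ₂ : Q₂ * Q₂ = Q₂) (hQ₂' : Q₂ᴴ = Q₂) (hQ₂r : Q₂.rank = 1)
    (horth : Q₁ * Q₂ = 0 ∧ Q₂ * Q₁ = 0)
    (hQ₃ : Q₃ = 1 - Q₁ - Q₂) :
    IdempotentCompressible
      {M : Mat n | ∃ (α β : ℂ) (T : Mat n), M = α • Q₁ + β • Q₂ + (Q₁ + Q₂) * T * Q₃} ∧
    IdempotentCompressible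
      (unitization
        {M : Mat n | ∃ (α β : ℂ) (T : Mat n), M = α • Q₁ + β • Q₂ + (Q₁ + Q₂) * T * Q₃}) := by
  obtain ⟨h12, h21⟩ := horth
  let S := {M : Mat n | ∃ (α β : ℂ) (T : Mat n), M = α • Q₁ + β • Q₂ + (Q₁ + Q₂) * T * Q₃}
  have h31 : Q₃ * Q₁ = 0 := by simp [hQ₃, sub_mul, hQ₁, h21]
  have h32 : Q₃ * Q₂ = 0 := by simp [hQ₃, sub_mul, hQ₂, h12]
  have hmem : ∀ C : Mat n, (Q₁ + Q₂) * C = C → Q₁ * C * Q₂ = 0 → Q₂ * C * Q₁ = 0 → C ∈ S := by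
    intro C hC hC12 hC21
    obtain ⟨α, hα⟩ := exists_mul_mul_eq_smul_of_rank_eq_one hQ₁r C
    obtain ⟨β, hβ⟩ := exists_mul_mul_eq_smul_of_rank_eq_one hQ₂r C
    refine ⟨α, β, C, ?_⟩
    have hsum : (Q₁ + Q₂) * C * Q₃ = (Q₁ + Q₂) * C - (Q₁ * C * Q₁ + Q₂ * C * Q₁)
        - (Q₁ * C * Q₂ + Q₂ * C * Q₂) := by
      rw [hQ₃]
      noncomm_ring
    rw [hsum, hC, hα, hβ, hC12, hC21]
    abel
  have hcompr : IdempotentCompressible S := by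
    rintro E hE _ ⟨A, ⟨a₁, a₂, T, hA⟩, rfl⟩ _ ⟨B, ⟨b₁, b₂, U, hB⟩, rfl⟩
    have hBQ₁ : B * Q₁ = b₁ • Q₁ := by
      simp [hB, add_mul, mul_assoc, hQ₁, h21, h31]
    have hBQ₂ : B * Q₂ = b₂ • Q₂ := by
      simp [hB, add_mul, mul_assoc, hQ₂, h12, h32]
    have hAQ₁ : A * Q₁ = a₁ • Q₁ := by
      simp [hA, add_mul, mul_assoc, hQ₁, h21, h31]
    have hAQ₂ : A * Q₂ = a₂ • Q₂ := by
      simp [hA, add_mul, mul_assoc, hQ₂, h12, h32]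
    have hP₁ : (Q₁ + Q₂) * Q₁ = Q₁ := by simp [add_mul, hQ₁, h21]
    have hP₂ : (Q₁ + Q₂) * Q₂ = Q₂ := by simp [add_mul, hQ₂, h12]
    have hPA : (Q₁ + Q₂) * A = A := by
      rw [hA]
      simp only [mul_add (Q₁ + Q₂), mul_smul_comm, hP₁, hP₂, ← mul_assoc]
    -- The last two terms vanish under compression and make `Q₁ * C * Q₂` and `Q₂ * C * Q₁` zero.
    refine ⟨A * E * B + b₂ • (Q₁ * A * (1 - E)) + b₁ • (Q₂ * A * (1 - E)),
      hmem _ ?_ ?_ ?_, ?_⟩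
    · simp only [mul_add (Q₁ + Q₂), mul_smul_comm, ← mul_assoc, hP₁, hP₂, hPA]
    · calc _ = Q₁ * A * E * (B * Q₂) + b₂ • (Q₁ * Q₁ * A * (1 - E) * Q₂)
            + b₁ • (Q₁ * Q₂ * A * (1 - E) * Q₂) := by
            simp only [mul_add, add_mul, mul_smul_comm, smul_mul_assoc, mul_assoc]
        _ = b₂ • (Q₁ * (A * Q₂)) := by
            rw [hBQ₂, hQ₁, h12]
            simp only [mul_sub, sub_mul, mul_one, mul_smul_comm, mul_assoc, zero_mul, smul_sub]
            simp
        _ = 0 := by simp [hAQ₂, h12]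
    · calc _ = Q₂ * A * E * (B * Q₁) + b₂ • (Q₂ * Q₁ * A * (1 - E) * Q₁)
            + b₁ • (Q₂ * Q₂ * A * (1 - E) * Q₁) := by
            simp only [mul_add, add_mul, mul_smul_comm, smul_mul_assoc, mul_assoc]
        _ = b₁ • (Q₂ * (A * Q₁)) := by
            rw [hBQ₁, hQ₂, h21]
            simp only [mul_sub, sub_mul, mul_one, mul_smul_comm, mul_assoc, zero_mul, smul_sub]
            simp
        _ = 0 := by simp [hAQ₁, h21]
    · have hE' : (1 - E) * E = 0 := by simp [sub_mul, hE]
      have hEE : ∀ X : Mat n, E * (E * X) = E * X := fun X => by rw [← mul_assoc, hE]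
      simp [mul_add, add_mul, mul_assoc, hE', hEE]
  refine ⟨hcompr, hcompr.unitization ?_ ?_⟩
  · rintro _ ⟨a₁, a₂, T, rfl⟩ _ ⟨b₁, b₂, U, rfl⟩
    refine ⟨a₁ + b₁, a₂ + b₂, T + U, ?_⟩
    rw [mul_add (Q₁ + Q₂), add_mul _ _ Q₃]
    module
  · rintro c _ ⟨a₁, a₂, T, rfl⟩
    refine ⟨c * a₁, c * a₂, c • T, ?_⟩
    rw [mul_smul_comm, smul_mul_assoc]
    module
end

section
/- Let Q₁, Q₂, Q₃ be rank-one orthogonal projections in M₃(ℂ) with Q₁ + Q₂ + Q₃ = I. Then the subalgebra 𝒜 := ℂ(Q₁+Q₂) + ℂQ₃ + Q₁·M₃(ℂ)·(Q₂+Q₃) = {α(Q₁+Q₂) + βQ₃ + Q₁T(Q₂+Q₃) : α, β ∈ ℂ, T ∈ M₃(ℂ)} is idempotent compressible. -/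
open Matrix

theorem Matrix.exists_eq_vecMulVec_of_rank_le_one {K m n : Type*} [Field K] [Fintype n]
    [DecidableEq n] [Finite m] {M : Matrix m n K} (h : M.rank ≤ 1) :
    ∃ (u : m → K) (v : n → K), M = vecMulVec u v := by
  obtain ⟨u, hu⟩ := finrank_le_one_iff.mp h
  choose c hc using fun j => hu ⟨M *ᵥ Pi.single j 1, LinearMap.mem_range_self M.mulVecLin _⟩
  refine ⟨u, c, ?_⟩
  ext i j
  have hij := congrFun (congrArg Subtype.val (hc j)) i
  simp only [SetLike.val_smul, Pi.smul_apply, smul_eq_mul, mulVec_single_one, col_apply] at hij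
  rw [vecMulVec_apply, mul_comm, hij]

/-- The general element of the algebra `ℂ(E₁₁ + E₂₂) + ℂE₃₃ + E₁₁ M₃(ℂ) (E₂₂ + E₃₃)`. -/
def modelMat (α β a b : ℂ) : Mat 3 := !![α, a, b; 0, α, 0; 0, 0, β]

theorem modelMat_mul (α β a b α' β' a' b' : ℂ) :
    modelMat α β a b * modelMat α' β' a' b' =
      modelMat (α * α') (β * β') (α * a' + a * α') (α * b' + b * β') := by
  ext i j
  fin_cases i <;> fin_cases j <;> simp [modelMat, Matrix.mul_apply, Fin.sum_univ_three]

theorem modelMat_sub (α β a b α' β' a' b' : ℂ) :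
    modelMat α β a b - modelMat α' β' a' b' =
      modelMat (α - α') (β - β') (a - a') (b - b') := by
  ext i j
  fin_cases i <;> fin_cases j <;> simp [modelMat]

theorem smul_modelMat (c α β a b : ℂ) :
    c • modelMat α β a b = modelMat (c * α) (c * β) (c * a) (c * b) := by
  ext i j
  fin_cases i <;> fin_cases j <;> simp [modelMat]

/-- Modulo matrices of the form `x zᵀ` and `z yᵀ`, the product `A x yᵀ B` of model matrices
`A`, `B` with `x yᵀ` is again a model matrix. -/
theorem exists_modelMat_mul_vecMulVec_mul (α β a b α' β' a' b' : ℂ) (x y : Fin 3 → ℂ) :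
    ∃ (α₀ β₀ a₀ b₀ : ℂ) (z w : Fin 3 → ℂ),
      modelMat α β a b * vecMulVec x y * modelMat α' β' a' b' =
        modelMat α₀ β₀ a₀ b₀ + vecMulVec x z + vecMulVec w y := by
  let k := (β - α) * a'
  let p := (β - α) * x 2
  let p' := (β' - α') * y 2
  let q := a * x 1 + b * x 2
  refine ⟨-k * x 1 * y 0, p * p' + p * y 0 * b',
    q * y 0 * a' - k * x 0 * y 0 - k * x 1 * y 1, q * (p' + y 0 * b') - k * x 1 * y 2,
    ![α * (α' * y 0), α * (a' * y 0 + α' * y 1) + k * y 0, α * (b' * y 0 + β' * y 2)],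
    ![α' * q + k * x 1, 0, α' * p], ?_⟩
  ext i j
  simp only [Matrix.add_apply, Matrix.mul_apply, vecMulVec_apply, Fin.sum_univ_three]
  fin_cases i <;> fin_cases j <;> simp [k, p, p', q, modelMat] <;> ring

theorem exists_compress_modelMat_mul {E : Mat 3} (hE : E * E = E) (α β a b α' β' a' b' : ℂ) :
    ∃ α₀ β₀ a₀ b₀ : ℂ,
      E * modelMat α β a b * E * (E * modelMat α' β' a' b' * E) =
        E * modelMat α₀ β₀ a₀ b₀ * E := by
  have hprod (A B : Mat 3) : E * A * E * (E * B * E) = E * A * E * B * E := by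
    rw [← mul_assoc, ← mul_assoc, mul_assoc (E * A) E E, hE]
  have hrank : E.rank + (1 - E).rank ≤ 3 :=
    rank_add_rank_le_card_of_mul_eq_zero (by rw [mul_sub, mul_one, hE, sub_self])
  rcases eq_or_ne E 1 with rfl | hE1
  · simp only [one_mul, mul_one, modelMat_mul]
    exact ⟨_, _, _, _, rfl⟩
  rcases le_or_gt E.rank 1 with h | h
  · obtain ⟨u, v, huv⟩ := exists_eq_vecMulVec_of_rank_le_one h
    obtain ⟨c, hc⟩ : ∃ c : ℂ, E * modelMat α β a b * E = c • E := by
      refine ⟨v ⬝ᵥ (modelMat α β a b *ᵥ u), ?_⟩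
      rw [huv, mul_assoc, mul_vecMulVec, vecMulVec_mul_vecMulVec, vecMulVec_smul]
    rw [hprod, hc, smul_mul_assoc, ← mul_smul_comm, smul_modelMat]
    exact ⟨_, _, _, _, rfl⟩
  · obtain ⟨x, y, hxy⟩ := exists_eq_vecMulVec_of_rank_le_one (M := 1 - E) (by lia)
    have hne : x ≠ 0 ∧ y ≠ 0 := by
      rw [← not_or, ← vecMulVec_eq_zero, ← hxy, sub_eq_zero]
      exact hE1.symm
    obtain ⟨α₀, β₀, a₀, b₀, z, w, hzw⟩ :=
      exists_modelMat_mul_vecMulVec_mul α β a b α' β' a' b' x y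
    have hEx (z : Fin 3 → ℂ) : E * vecMulVec x z * E = 0 := by
      have h0 : vecMulVec (E *ᵥ x) y = 0 := by
        rw [← mul_vecMulVec, ← hxy, mul_sub, mul_one, hE, sub_self]
      rw [mul_vecMulVec, (vecMulVec_eq_zero.mp h0).resolve_right hne.2, zero_vecMulVec, zero_mul]
    have hyE (w : Fin 3 → ℂ) : E * vecMulVec w y * E = 0 := by
      have h0 : vecMulVec x (y ᵥ* E) = 0 := by
        rw [← vecMulVec_mul, ← hxy, sub_mul, one_mul, hE, sub_self]
      rw [mul_assoc, vecMulVec_mul, (vecMulVec_eq_zero.mp h0).resolve_left hne.1, vecMulVec_zero,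
        mul_zero]
    have hkey : E * modelMat α β a b * E * modelMat α' β' a' b' * E =
        E * (modelMat α β a b * modelMat α' β' a' b') * E -
          E * (modelMat α β a b * vecMulVec x y * modelMat α' β' a' b') * E := by
      rw [← hxy]; noncomm_ring
    rw [hprod, hkey, hzw, mul_add, mul_add, add_mul, add_mul, hEx, hyE, add_zero, add_zero,
      ← sub_mul, ← mul_sub, modelMat_mul, modelMat_sub]
    exact ⟨_, _, _, _, rfl⟩

/-- Example 3.2.5: if `Q₁, Q₂, Q₃` are rank-one orthogonal projections in `M₃(ℂ)`
summing to `I`, then `ℂ(Q₁+Q₂) + ℂQ₃ + Q₁ M₃(ℂ) (Q₂+Q₃)` is idempotent compressible. -/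
theorem example_3_2_5 (Q₁ Q₂ Q₃ : Mat 3)
    (hQ₁ : Q₁ * Q₁ = Q₁) (hQ₁' : Q₁ᴴ = Q₁) (hQ₁r : Q₁.rank = 1)
    (hQ₂ : Q₂ * Q₂ = Q₂) (hQ₂' : Q₂ᴴ = Q₂) (hQ₂r : Q₂.rank = 1)
    (hQ₃ : Q₃ * Q₃ = Q₃) (hQ₃' : Q₃ᴴ = Q₃) (hQ₃r : Q₃.rank = 1)
    (hsum : Q₁ + Q₂ + Q₃ = 1) :
    IdempotentCompressible
      {M : Mat 3 | ∃ (α β : ℂ) (T : Mat 3),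
        M = α • (Q₁ + Q₂) + β • Q₃ + Q₁ * T * (Q₂ + Q₃)} := by
  obtain ⟨u₁, v₁, h₁⟩ := exists_eq_vecMulVec_of_rank_le_one hQ₁r.le
  obtain ⟨u₂, v₂, h₂⟩ := exists_eq_vecMulVec_of_rank_le_one hQ₂r.le
  obtain ⟨u₃, v₃, h₃⟩ := exists_eq_vecMulVec_of_rank_le_one hQ₃r.le
  let U : Mat 3 := (of ![u₁, u₂, u₃])ᵀ
  let V : Mat 3 := of ![v₁, v₂, v₃]
  have hconj (d : Fin 3 → ℂ) : U * diagonal d * V = d 0 • Q₁ + d 1 • Q₂ + d 2 • Q₃ := by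
    ext i j
    simp [U, V, h₁, h₂, h₃, Matrix.mul_apply, Fin.sum_univ_three, vecMulVec_apply, diagonal]
    ring
  have hUV : U * V = 1 := by
    simpa [hsum] using hconj 1
  have hVU : V * U = 1 := mul_eq_one_comm.mp hUV
  have hQ₁U : Q₁ = U * diagonal ![1, 0, 0] * V := by simp [hconj]
  have hQ₂₃ : Q₂ + Q₃ = U * diagonal ![0, 1, 1] * V := by simp [hconj]
  have hmem (M : Mat 3) : (∃ (α β : ℂ) (T : Mat 3),
      M = α • (Q₁ + Q₂) + β • Q₃ + Q₁ * T * (Q₂ + Q₃)) ↔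
      ∃ α β a b : ℂ, M = U * modelMat α β a b * V := by
    have hform (α β : ℂ) (T : Mat 3) : α • (Q₁ + Q₂) + β • Q₃ + Q₁ * T * (Q₂ + Q₃) =
        U * modelMat α β ((V * T * U) 0 1) ((V * T * U) 0 2) * V := by
      have hmodel (S : Mat 3) : modelMat α β (S 0 1) (S 0 2) = diagonal ![α, α, β] +
          diagonal ![1, 0, 0] * S * diagonal ![0, 1, 1] := by
        ext i j
        fin_cases i <;> fin_cases j <;> simp [modelMat]
      have hQT : Q₁ * T * (Q₂ + Q₃) =
          U * (diagonal ![1, 0, 0] * (V * T * U) * diagonal ![0, 1, 1]) * V := by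
        rw [hQ₁U, hQ₂₃]; simp only [mul_assoc]
      rw [hmodel, hQT, mul_add U, add_mul, hconj]
      simp
    constructor
    · rintro ⟨α, β, T, rfl⟩
      exact ⟨α, β, _, _, hform α β T⟩
    · rintro ⟨α, β, a, b, rfl⟩
      refine ⟨α, β, U * !![0, a, b; 0, 0, 0; 0, 0, 0] * V, ?_⟩
      have hS (S : Mat 3) : V * (U * S * V) * U = S := by
        rw [← mul_assoc, ← mul_assoc, hVU, one_mul, mul_assoc, hVU, mul_one]
      rw [hform, hS]
      simp
  intro E hE
  have hE' : V * E * U * (V * E * U) = V * E * U := by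
    calc V * E * U * (V * E * U) = V * E * (U * V) * E * U := by simp only [mul_assoc]
      _ = V * E * U := by rw [hUV, mul_one, mul_assoc V, hE]
  have hcomp (M : Mat 3) : E * (U * M * V) * E = U * (V * E * U * M * (V * E * U)) * V := by
    calc E * (U * M * V) * E = (U * V) * E * U * M * V * E * (U * V) := by
          rw [hUV, one_mul, mul_one]; simp only [mul_assoc]
      _ = _ := by simp only [mul_assoc]
  rintro _ ⟨A, hA, rfl⟩ _ ⟨B, hB, rfl⟩
  obtain ⟨α, β, a, b, rfl⟩ := (hmem A).mp hA
  obtain ⟨α', β', a', b', rfl⟩ := (hmem B).mp hB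
  obtain ⟨α₀, β₀, a₀, b₀, h₀⟩ := exists_compress_modelMat_mul hE' α β a b α' β' a' b'
  refine ⟨U * modelMat α₀ β₀ a₀ b₀ * V, (hmem _).mpr ⟨_, _, _, _, rfl⟩, ?_⟩
  have hUVmul (X Y : Mat 3) : U * X * V * (U * Y * V) = U * (X * Y) * V := by
    calc U * X * V * (U * Y * V) = U * X * (V * U) * Y * V := by simp only [mul_assoc]
      _ = U * (X * Y) * V := by rw [hVU, mul_one, mul_assoc U]
  simp only [hcomp, hUVmul, h₀]
end
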